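/- The kernel of τ[t] : F(𝔞) → 𝔞[t] is contained in the two-sided ideal of the tensor algebra T(𝔞) generated by the elements x⊗y − y⊗x − [x,y] for x, y ∈ 𝔞. -/

import Mathlib

open TensorAlgebra TensorProduct Polynomial

noncomputable section

/-- The graded pieces `F^r(a)` of the free Lie algebra on the vector space `a`,
realized inside the tensor algebra `T(a)`:  `F¹(a) = ι(a)` and `F^{r+1}(a)` is spanned by
the commutators `ι(x) * y - y * ι(x)` with `x ∈ a`, `y ∈ F^r(a)`. -/
def Fr (a : Type*) [LieRing a] [LieAlgebra ℂ a] : ℕ → Submodule ℂ (TensorAlgebra ℂ a)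
  | 0 => ⊥
  | 1 => LinearMap.range (TensorAlgebra.ι ℂ (M := a))
  | (r + 2) => Submodule.span ℂ
      {u | ∃ (x : a) (y : TensorAlgebra ℂ a), y ∈ Fr a (r + 1) ∧
        u = TensorAlgebra.ι ℂ x * y - y * TensorAlgebra.ι ℂ x}

/-- The free Lie algebra `F(a) = ⊕_{r>0} F^r(a)` on the vector space `a`,
as a subspace of the tensor algebra. -/
def FLie (a : Type*) [LieRing a] [LieAlgebra ℂ a] : Submodule ℂ (TensorAlgebra ℂ a) :=
  ⨆ r, Fr a r

/-- `IsTau a τ` says that the linear map `τ` is (a linear extension to `T(a)` of) the canonical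
Lie algebra homomorphism `τ : F(a) → a`: it is the identity on `F¹(a) = a` and takes the
commutator bracket of `T(a)` (restricted to `F(a)`) to the bracket of `a`. -/
def IsTau (a : Type*) [LieRing a] [LieAlgebra ℂ a] (τ : TensorAlgebra ℂ a →ₗ[ℂ] a) : Prop :=
  (∀ x : a, τ (TensorAlgebra.ι ℂ x) = x) ∧
  ∀ r s : ℕ, ∀ u ∈ Fr a r, ∀ v ∈ Fr a s, τ (u * v - v * u) = ⁅τ u, τ v⁆

/-- The current algebra `a[t] = a ⊗ ℂ[t]`, with bracket `⁅x ⊗ f, y ⊗ g⁆ = ⁅x, y⁆ ⊗ fg`. -/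
abbrev Cur (a : Type*) [LieRing a] [LieAlgebra ℂ a] : Type _ := Polynomial ℂ ⊗[ℂ] a

/-- `IsTauT a τ τt` says that the linear map `τt` is (a linear extension to `T(a)` of) the map
`τ[t] : F(a) → a[t]` given by `τ[t](𝐱) = τ(𝐱) ⊗ t^r` for `𝐱 ∈ F^r(a)`. -/
def IsTauT (a : Type*) [LieRing a] [LieAlgebra ℂ a] (τ : TensorAlgebra ℂ a →ₗ[ℂ] a)
    (τt : TensorAlgebra ℂ a →ₗ[ℂ] Cur a) : Prop :=
  ∀ r : ℕ, ∀ u ∈ Fr a r, τt u = ((X : ℂ[X]) ^ r) ⊗ₜ[ℂ] (τ u)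

end

/-- The two-sided ideal of `T(a)` generated by the elements `x ⊗ y - y ⊗ x - [x,y]`,
as a subspace. -/
abbrev envelopingIdeal (a : Type*) [LieRing a] [LieAlgebra ℂ a] :
    Submodule ℂ (TensorAlgebra ℂ a) :=
  Submodule.span ℂ {w : TensorAlgebra ℂ a |
    ∃ (p q : TensorAlgebra ℂ a) (x y : a),
      w = p * (TensorAlgebra.ι ℂ x * TensorAlgebra.ι ℂ y
        - TensorAlgebra.ι ℂ y * TensorAlgebra.ι ℂ x - TensorAlgebra.ι ℂ ⁅x, y⁆) * q}

section

variable {a : Type*} [LieRing a] [LieAlgebra ℂ a]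

lemma mul_mem_envelopingIdeal (z : TensorAlgebra ℂ a) {w : TensorAlgebra ℂ a}
    (hw : w ∈ envelopingIdeal a) : z * w ∈ envelopingIdeal a := by
  induction hw using Submodule.span_induction with
  | mem w hw =>
    obtain ⟨p, q, x, y, rfl⟩ := hw
    exact Submodule.subset_span ⟨z * p, q, x, y, by simp only [mul_assoc]⟩
  | zero => simp
  | add u v _ _ hu hv => rw [mul_add]; exact add_mem hu hv
  | smul c u _ hu => rw [mul_smul_comm]; exact Submodule.smul_mem _ c hu

lemma mem_envelopingIdeal_mul (z : TensorAlgebra ℂ a) {w : TensorAlgebra ℂ a}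
    (hw : w ∈ envelopingIdeal a) : w * z ∈ envelopingIdeal a := by
  induction hw using Submodule.span_induction with
  | mem w hw =>
    obtain ⟨p, q, x, y, rfl⟩ := hw
    exact Submodule.subset_span ⟨p, q * z, x, y, by simp only [mul_assoc]⟩
  | zero => simp
  | add u v _ _ hu hv => rw [add_mul]; exact add_mem hu hv
  | smul c u _ hu => rw [smul_mul_assoc]; exact Submodule.smul_mem _ c hu

lemma commutator_sub_bracket_mem_envelopingIdeal (x y : a) :
    TensorAlgebra.ι ℂ x * TensorAlgebra.ι ℂ y - TensorAlgebra.ι ℂ y * TensorAlgebra.ι ℂ x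
      - TensorAlgebra.ι ℂ ⁅x, y⁆ ∈ envelopingIdeal a :=
  Submodule.subset_span ⟨1, 1, x, y, by simp⟩

/-- Modulo the ideal, an element of `F^r(a)` is its image under `τ`. -/
lemma sub_ι_mem_envelopingIdeal_of_mem_Fr {τ : TensorAlgebra ℂ a →ₗ[ℂ] a} (hτ : IsTau a τ) :
    ∀ (r : ℕ), ∀ u ∈ Fr a r, u - TensorAlgebra.ι ℂ (τ u) ∈ envelopingIdeal a
  | 0, u, hu => by
    obtain rfl : u = 0 := by simpa [Fr] using hu
    simp
  | 1, u, hu => by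
    obtain ⟨x, rfl⟩ : ∃ x, TensorAlgebra.ι ℂ x = u := by simpa [Fr] using hu
    simp [hτ.1 x]
  | r + 2, u, hu => by
    simp only [Fr] at hu
    induction hu using Submodule.span_induction with
    | mem u hu =>
      obtain ⟨x, y, hy, rfl⟩ := hu
      have hx : TensorAlgebra.ι ℂ x ∈ Fr a 1 := by simp [Fr]
      rw [hτ.2 1 (r + 1) _ hx y hy, hτ.1]
      have ih := sub_ι_mem_envelopingIdeal_of_mem_Fr hτ (r + 1) y hy
      convert add_mem (sub_mem (mul_mem_envelopingIdeal (TensorAlgebra.ι ℂ x) ih)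
        (mem_envelopingIdeal_mul (TensorAlgebra.ι ℂ x) ih))
        (commutator_sub_bracket_mem_envelopingIdeal x (τ y)) using 1
      noncomm_ring
    | zero => simp
    | add u v _ _ hu hv =>
      rw [map_add, map_add, add_sub_add_comm]
      exact add_mem hu hv
    | smul c u _ hu =>
      rw [map_smul, map_smul, ← smul_sub]
      exact Submodule.smul_mem _ c hu

lemma sub_ι_mem_envelopingIdeal {τ : TensorAlgebra ℂ a →ₗ[ℂ] a} (hτ : IsTau a τ)
    {u : TensorAlgebra ℂ a} (hu : u ∈ FLie a) :
    u - TensorAlgebra.ι ℂ (τ u) ∈ envelopingIdeal a := by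
  have h : FLie a ≤ (envelopingIdeal a).comap
      (LinearMap.id - (TensorAlgebra.ι ℂ).comp τ) :=
    iSup_le fun r v hv => sub_ι_mem_envelopingIdeal_of_mem_Fr hτ r v hv
  exact h hu

/-- Evaluation `a[t] → a` at `t = 1`. -/
noncomputable def evalOne (a : Type*) [LieRing a] [LieAlgebra ℂ a] : Cur a →ₗ[ℂ] a :=
  (TensorProduct.lid ℂ a).toLinearMap ∘ₗ (Polynomial.leval (1 : ℂ)).rTensor a

lemma evalOne_apply_eq {τ : TensorAlgebra ℂ a →ₗ[ℂ] a} {τt : TensorAlgebra ℂ a →ₗ[ℂ] Cur a}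
    (hτt : IsTauT a τ τt) {u : TensorAlgebra ℂ a} (hu : u ∈ FLie a) :
    evalOne a (τt u) = τ u := by
  have h : FLie a ≤ LinearMap.eqLocus ((evalOne a).comp τt) τ :=
    iSup_le fun r v hv => by simp [evalOne, hτt r v hv, Polynomial.leval_apply]
  exact h hu

end

/-- The kernel of `τ[t] : F(a) → a[t]` is contained in the two-sided ideal of
the tensor algebra `T(a)` generated by the elements `x ⊗ y - y ⊗ x - [x,y]` for `x, y ∈ a`. -/
theorem statement1 (a : Type*) [LieRing a] [LieAlgebra ℂ a]
    (τ : TensorAlgebra ℂ a →ₗ[ℂ] a) (hτ : IsTau a τ)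
    (τt : TensorAlgebra ℂ a →ₗ[ℂ] Cur a) (hτt : IsTauT a τ τt) :
    ∀ u ∈ FLie a, τt u = 0 →
      u ∈ Submodule.span ℂ {w : TensorAlgebra ℂ a |
        ∃ (p q : TensorAlgebra ℂ a) (x y : a),
          w = p * (TensorAlgebra.ι ℂ x * TensorAlgebra.ι ℂ y
            - TensorAlgebra.ι ℂ y * TensorAlgebra.ι ℂ x - TensorAlgebra.ι ℂ ⁅x, y⁆) * q} := by
  intro u hu h
  have hτu : τ u = 0 := by rw [← evalOne_apply_eq hτt hu, h, map_zero]
  simpa only [hτu, map_zero, sub_zero] using sub_ι_mem_envelopingIdeal hτ hu
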